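/- arXiv:1807.09921 — 2 statements merged into one kernel-verified Lean document; each statement's English description precedes it below -/
import Mathlib

section
/- Let G be a finite group, let A be an abelian normal subgroup of G, and let H be a subgroup of G such that G = HA. Then there exist finitely many subgroups H_1, …, H_n of G and one-dimensional characters χ_1, …, χ_n, where χ_i is a character of H_i, such that Ind_H^G 1_H = Σ_{i=1}^n Ind_{H_i}^G χ_i; in particular, every irreducible constituent of Ind_H^G 1_H is a monomial character of G. -/
open scoped Classical

/-- `f : G → ℂ` is the character of some finite-dimensional complex representation of `G`. -/
def IsChar (G : Type) [Group G] (f : G → ℂ) : Prop :=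
  ∃ V : FDRep ℂ G, f = V.character

/-- `f : G → ℂ` is the character of some irreducible (simple) finite-dimensional complex
representation of `G`. -/
def IsIrrChar (G : Type) [Group G] (f : G → ℂ) : Prop :=
  ∃ V : FDRep ℂ G, CategoryTheory.Simple V ∧ f = V.character

/-- Induction of a class function from a subgroup `H` of `G` to `G`:
`(Ind_H^G f)(x) = |H|⁻¹ ∑_{g ∈ G} f̂(g⁻¹ x g)`, where `f̂` agrees with `f` on `H`
and vanishes off `H`. -/
noncomputable def indChar {G : Type} [Group G] [Fintype G] (H : Subgroup G) (f : H → ℂ) :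
    G → ℂ := fun x =>
  (Nat.card H : ℂ)⁻¹ * ∑ g : G, if h : g⁻¹ * x * g ∈ H then f ⟨g⁻¹ * x * g, h⟩ else 0

/-- The usual inner product of class functions on a finite group:
`(f₁, f₂) = |G|⁻¹ ∑_{g ∈ G} f₁(g) conj (f₂ g)`. -/
noncomputable def cfInner (G : Type) [Group G] [Fintype G] (f₁ f₂ : G → ℂ) : ℂ :=
  (Fintype.card G : ℂ)⁻¹ * ∑ g : G, f₁ g * (starRingEnd ℂ) (f₂ g)

/-- The regular character of a finite group `G` (the character of the regular
representation, i.e. `Reg_G = ∑_{χ ∈ Irr G} χ(1)·χ`): it takes the value `|G|` at the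
identity and `0` elsewhere. -/
noncomputable def regChar (G : Type) [Group G] [Fintype G] : G → ℂ :=
  fun g => if g = 1 then (Fintype.card G : ℂ) else 0

/-- The level `l(χ)` of a character of a solvable group: the least `i ≥ 0` such that the
restriction of `χ` to the `i`-th derived subgroup `G^i` equals `χ(1)` times the trivial
character of `G^i`. -/
noncomputable def charLevel (G : Type) [Group G] (χ : G → ℂ) : ℕ :=
  sInf {i : ℕ | ∀ g ∈ derivedSeries G i, χ g = χ 1}

open Matrix ComplexOrder in
/-- The trace of `M g⁻¹` is the conjugate of that of `M g`, since the matrices of a finite group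
preserve a positive definite Hermitian form. -/
theorem trace_inv_eq_conj_trace {G ι : Type*} [Group G] [Fintype G] [Fintype ι] [DecidableEq ι]
    (M : G →* Matrix ι ι ℂ) (g : G) :
    (M g⁻¹).trace = (starRingEnd ℂ) (M g).trace := by
  set P : Matrix ι ι ℂ := ∑ x : G, (M x)ᴴ * M x with hP
  have hpos : P.PosDef := by
    rw [hP, ← Finset.add_sum_erase _ _ (Finset.mem_univ (1 : G))]
    refine Matrix.PosDef.add_posSemidef ?_ ?_
    · simpa using Matrix.PosDef.one
    · exact Matrix.posSemidef_sum _ fun x _ => Matrix.posSemidef_conjTranspose_mul_self _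
  have hinv : (M g)ᴴ * P * M g = P := by
    rw [hP, Finset.mul_sum, Finset.sum_mul]
    refine Fintype.sum_equiv (Equiv.mulRight g) _ _ fun x => ?_
    simp [Matrix.mul_assoc]
  have hM : M g * M g⁻¹ = 1 := by rw [← map_mul]; simp
  have hPu : IsUnit P.det := (Matrix.isUnit_iff_isUnit_det _).1 hpos.isUnit
  have h1 : (M g)ᴴ * P = P * M g⁻¹ := by
    calc (M g)ᴴ * P = ((M g)ᴴ * P * M g) * M g⁻¹ := by rw [Matrix.mul_assoc _ _ (M g⁻¹), hM, mul_one]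
      _ = _ := by rw [hinv]
  have h2 : M g⁻¹ = P⁻¹ * ((M g)ᴴ * P) := by
    rw [h1, Matrix.nonsing_inv_mul_cancel_left _ _ hPu]
  rw [h2, Matrix.trace_mul_comm, Matrix.mul_nonsing_inv_cancel_right _ _ hPu,
    Matrix.trace_conjTranspose]
  rfl

theorem FDRep.character_inv {G : Type} [Group G] [Fintype G] (V : FDRep ℂ G) (g : G) :
    V.character g⁻¹ = (starRingEnd ℂ) (V.character g) := by
  let b := Module.finBasis ℂ V
  have h := trace_inv_eq_conj_trace
    ((MonoidHomClass.toMonoidHom (LinearMap.toMatrixAlgEquiv b)).comp V.ρ) g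
  simpa [FDRep.character, LinearMap.trace_eq_matrix_trace ℂ b, LinearMap.toMatrixAlgEquiv] using h

theorem isChar_of_monoidHom {K : Type} [Group K] (θ : K →* ℂ) : IsChar K θ := by
  let ρ : Representation ℂ K ℂ :=
    ((algebraMap ℂ (Module.End ℂ ℂ)) : ℂ →* Module.End ℂ ℂ).comp θ
  refine ⟨FDRep.of ρ, ?_⟩
  ext g
  change θ g = LinearMap.trace ℂ ℂ (algebraMap ℂ (Module.End ℂ ℂ) (θ g))
  rw [Algebra.algebraMap_eq_smul_one]
  simp

theorem cfInner_sum_left {G ι : Type} [Group G] [Fintype G] [Fintype ι] (f : ι → G → ℂ)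
    (ψ : G → ℂ) : cfInner G (∑ i, f i) ψ = ∑ i, cfInner G (f i) ψ := by
  simp only [cfInner, Finset.sum_apply, Finset.sum_mul]
  rw [Finset.sum_comm, Finset.mul_sum]

theorem Subgroup.sum_eq_sum_dite {G : Type} [Group G] [Fintype G] (K : Subgroup G) (F : K → ℂ) :
    ∑ k : K, F k = ∑ x : G, if h : x ∈ K then F ⟨x, h⟩ else 0 := by
  refine Fintype.sum_of_injective Subtype.val Subtype.val_injective _ _ (fun x hx => ?_) fun k => ?_
  · exact dif_neg fun h => hx ⟨⟨x, h⟩, rfl⟩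
  · simp

theorem cfInner_indChar_left {G : Type} [Group G] [Fintype G] (K : Subgroup G) (f : K → ℂ)
    (ψ : G → ℂ) (hψ : ∀ g x, ψ (g * x * g⁻¹) = ψ x) :
    cfInner G (indChar K f) ψ = cfInner K f (fun k => ψ k) := by
  have key : ∀ g : G, (∑ x : G, (if h : g⁻¹ * x * g ∈ K then f ⟨g⁻¹ * x * g, h⟩ else 0) *
      (starRingEnd ℂ) (ψ x)) = ∑ k : K, f k * (starRingEnd ℂ) (ψ k) := by
    intro g
    rw [Subgroup.sum_eq_sum_dite]
    refine Fintype.sum_equiv (MulAut.conj g⁻¹).toEquiv _ _ fun x => ?_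
    have hx : ψ (g⁻¹ * x * g) = ψ x := by simpa using hψ g⁻¹ x
    simp [hx]
  simp only [cfInner, indChar, mul_assoc, Finset.sum_mul]
  rw [← Finset.mul_sum, Finset.sum_comm]
  simp only [← mul_assoc] at key ⊢
  simp only [key]
  simp
  field_simp

/-- A function of norm one whose inner product with another function of norm one is a nonzero
natural number equals the latter. -/
theorem eq_of_cfInner_natCast {G : Type} [Group G] [Fintype G] (f ψ : G → ℂ)
    (hf : cfInner G f f = 1) (hψ : cfInner G ψ ψ = 1) (m : ℕ) (hm : m ≠ 0)
    (h : cfInner G f ψ = m) : f = ψ := by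
  have h' : cfInner G ψ f = m := by
    have h2 := congrArg (starRingEnd ℂ) h
    simpa [cfInner, mul_comm] using h2
  have hd : ((Fintype.card G : ℝ)⁻¹ * ∑ x, Complex.normSq (f x - ψ x) : ℝ) = 2 - 2 * (m : ℝ) := by
    have : (((Fintype.card G : ℝ)⁻¹ * ∑ x, Complex.normSq (f x - ψ x) : ℝ) : ℂ)
        = cfInner G f f - cfInner G f ψ - cfInner G ψ f + cfInner G ψ ψ := by
      simp only [cfInner, ← mul_sub, ← mul_add, ← Finset.sum_sub_distrib, ← Finset.sum_add_distrib]
      push_cast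
      congr 1
      refine Finset.sum_congr rfl fun x _ => ?_
      rw [Complex.normSq_eq_conj_mul_self]
      simp only [map_sub]
      ring
    rw [hf, hψ, h, h'] at this
    have h3 := congrArg Complex.re this
    simp only [Complex.ofReal_re] at h3
    rw [h3]
    simp
    ring
  have hm1 : (1 : ℝ) ≤ m := by exact_mod_cast Nat.one_le_iff_ne_zero.2 hm
  have hc : (0 : ℝ) < (Fintype.card G : ℝ)⁻¹ := by
    have : 0 < Fintype.card G := Fintype.card_pos
    positivity
  have hs : ∑ x, Complex.normSq (f x - ψ x) = 0 := by
    refine le_antisymm ?_ (Finset.sum_nonneg fun x _ => Complex.normSq_nonneg _)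
    by_contra! hlt
    have := mul_pos hc hlt
    linarith
  rw [Finset.sum_eq_zero_iff_of_nonneg fun x _ => Complex.normSq_nonneg _] at hs
  funext x
  exact sub_eq_zero.1 (Complex.normSq_eq_zero.1 (hs x (Finset.mem_univ x)))

theorem cfInner_self_of_isIrrChar {G : Type} [Group G] [Fintype G] (ψ : G → ℂ)
    (hψ : IsIrrChar G ψ) : cfInner G ψ ψ = 1 := by
  obtain ⟨V, hV, rfl⟩ := hψ
  have : Invertible (Nat.card G : ℂ) := invertibleOfNonzero (by simp)
  have h := FDRep.char_orthonormal V V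
  rw [if_pos ⟨CategoryTheory.Iso.refl V⟩] at h
  simpa [cfInner, FDRep.character_inv] using h

theorem cfInner_indChar_isNat {G : Type} [Group G] [Fintype G] (K : Subgroup G) (f : K → ℂ)
    (hf : IsChar K f) (ψ : G → ℂ) (hψ : IsChar G ψ) :
    ∃ m : ℕ, cfInner G (indChar K f) ψ = m := by
  obtain ⟨V, rfl⟩ := hψ
  obtain ⟨W, rfl⟩ := hf
  rw [cfInner_indChar_left _ _ _ (fun g x => V.char_conj x g)]
  let V' : FDRep ℂ K := FDRep.of (V.ρ.comp K.subtype)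
  have : Invertible (Nat.card K : ℂ) := invertibleOfNonzero (by simp)
  refine ⟨_, Eq.trans ?_ (FDRep.scalar_product_char_eq_finrank_equivariant V' W)⟩
  simp only [cfInner, FDRep.character_inv]
  simp
  rfl

/-- `l` is trivial on `A ∩ H`. -/
def TrivialOn {G : Type} [Group G] {A : Subgroup G} (H : Subgroup G) (l : A →* ℂˣ) : Prop :=
  ∀ a : A, (a : G) ∈ H → l a = 1

section LinearExtension

variable {G : Type} [Group G] {A : Subgroup G} [A.Normal]

/-- `G` acts on the linear characters of a normal subgroup by conjugation. -/
noncomputable instance conjMulAction : MulAction G (A →* ℂˣ) where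
  smul g l := l.comp (MulAut.conjNormal g⁻¹ : MulAut A).toMonoidHom
  one_smul l := by
    ext a
    change ((l (MulAut.conjNormal 1⁻¹ a) : ℂˣ) : ℂ) = l a
    simp
  mul_smul g h l := by
    ext a
    change ((l (MulAut.conjNormal (g * h)⁻¹ a) : ℂˣ) : ℂ) =
      l (MulAut.conjNormal h⁻¹ (MulAut.conjNormal g⁻¹ a))
    rw [mul_inv_rev, map_mul, MulAut.mul_apply]

theorem conj_smul_apply (g : G) (l : A →* ℂˣ) (a : A) :
    (g • l) a = l (MulAut.conjNormal g⁻¹ a) := rfl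

theorem apply_conj_of_smul_eq {g : G} {l : A →* ℂˣ} (hg : g • l = l) (a : A) :
    l (MulAut.conjNormal g⁻¹ a) = l a := by
  rw [← conj_smul_apply, hg]

theorem smul_eq_self_of_mem [IsMulCommutative A] {g : G} (hg : g ∈ A) (l : A →* ℂˣ) :
    g • l = l := by
  ext a
  rw [conj_smul_apply]
  congr 2
  ext
  have := congrArg Subtype.val (mul_comm' (⟨g, hg⟩ : A) a)
  simp only [Subgroup.coe_mul] at this
  simp [mul_assoc, ← this]

/-- The extension by zero to `G` of the linear character `h * a ↦ l a` of the stabilizer of `l`,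
where `h ∈ H` and `a ∈ A`. -/
noncomputable def linExt (H : Subgroup G) (l : A →* ℂˣ) (x : G) : ℂ :=
  if h : x • l = l ∧ ∃ a : A, x * (a : G)⁻¹ ∈ H then l h.2.choose else 0

variable {H : Subgroup G} {l : A →* ℂˣ}

theorem linExt_eq_zero {x : G} (hx : x • l ≠ l) : linExt H l x = 0 :=
  dif_neg fun h => hx h.1

theorem linExt_mul (hl : TrivialOn H l) {h : G} (hh : h ∈ H) (a : A) (hx : (h * a) • l = l) :
    linExt H l (h * a) = l a := by
  have hex : (h * a) • l = l ∧ ∃ b : A, (h * a) * (b : G)⁻¹ ∈ H := ⟨hx, a, by simpa⟩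
  rw [linExt, dif_pos hex]
  have hb := hex.2.choose_spec
  set b := hex.2.choose
  have : l (a * b⁻¹) = 1 := hl _ (by
    have := H.mul_mem (H.inv_mem hh) hb
    simpa [mul_assoc] using this)
  rw [map_mul, map_inv, mul_inv_eq_one] at this
  rw [this]

variable [IsMulCommutative A]

theorem mul_smul_eq_iff (h : G) (a : A) : (h * a) • l = l ↔ h • l = l := by
  rw [mul_smul, smul_eq_self_of_mem a.2]

theorem TrivialOn.smul (hprod : ∀ g : G, ∃ h ∈ H, ∃ a ∈ A, g = h * a) (hl : TrivialOn H l) (g : G) :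
    TrivialOn H (g • l) := by
  obtain ⟨h, hh, a, ha, rfl⟩ := hprod g
  intro b hb
  rw [mul_smul, smul_eq_self_of_mem ha, conj_smul_apply]
  refine hl _ ?_
  rw [MulAut.conjNormal_apply]
  exact H.mul_mem (H.mul_mem (H.inv_mem hh) hb) (H.inv_mem (H.inv_mem hh))

/-- The extension of `l` as a homomorphism on its stabilizer. -/
noncomputable def stabilizerExt (hprod : ∀ g : G, ∃ h ∈ H, ∃ a ∈ A, g = h * a)
    (hl : TrivialOn H l) : MulAction.stabilizer G l →* ℂ where
  toFun x := linExt H l x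
  map_one' := by
    have := linExt_mul hl H.one_mem (1 : A) (by simp)
    simpa using this
  map_mul' := by
    rintro ⟨x, hx⟩ ⟨y, hy⟩
    obtain ⟨h, hh, a, ha, rfl⟩ := hprod x
    obtain ⟨k, hk, b, hb, rfl⟩ := hprod y
    rw [MulAction.mem_stabilizer_iff] at hx hy
    lift a to A using ha
    lift b to A using hb
    have hk' : k • l = l := (mul_smul_eq_iff k b).1 hy
    have e : h * (a : G) * (k * b) = (h * k) * ((MulAut.conjNormal k⁻¹ a * b : A) : G) := by
      simp [mul_assoc]
    have hxy : (h * (a : G) * (k * b)) • l = l := by rw [mul_smul, hy, hx]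
    change linExt H l (h * (a : G) * (k * b)) = linExt H l (h * a) * linExt H l (k * b)
    rw [e] at hxy ⊢
    rw [linExt_mul hl (H.mul_mem hh hk) _ hxy, linExt_mul hl hh _ hx, linExt_mul hl hk _ hy,
      map_mul, apply_conj_of_smul_eq hk']
    simp

theorem linExt_conj (hprod : ∀ g : G, ∃ h ∈ H, ∃ a ∈ A, g = h * a) (hl : TrivialOn H l) (g x : G) :
    linExt H l (g⁻¹ * x * g) = linExt H (g • l) x := by
  obtain ⟨x, rfl⟩ : ∃ y, x = g * y * g⁻¹ := ⟨g⁻¹ * x * g, by group⟩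
  have e : g⁻¹ * (g * x * g⁻¹) * g = x := by group
  rw [e]
  have hiff : (g * x * g⁻¹) • g • l = g • l ↔ x • l = l := by
    rw [smul_smul, inv_mul_cancel_right, mul_smul, smul_left_cancel_iff]
  by_cases hx : x • l = l
  · have hgx := hiff.2 hx
    obtain ⟨h, hh, a, ha, rfl⟩ := hprod x
    obtain ⟨k, hk, b, hb, rfl⟩ := hprod g
    lift a to A using ha
    lift b to A using hb
    have hh' : h • l = l := (mul_smul_eq_iff h a).1 hx
    have e2 : k * b * (h * a) * (k * (b : G))⁻¹ = (k * h * k⁻¹) *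
        ((MulAut.conjNormal k (MulAut.conjNormal h⁻¹ b * a * b⁻¹) : A) : G) := by
      simp [MulAut.conjNormal_apply, mul_assoc]
    rw [e2] at hgx ⊢
    rw [linExt_mul hl hh _ hx,
      linExt_mul (hl.smul hprod _) (H.mul_mem (H.mul_mem hk hh) (H.inv_mem hk)) _ hgx, mul_smul,
      smul_eq_self_of_mem b.2, conj_smul_apply]
    have hcancel (c : A) : MulAut.conjNormal k⁻¹ (MulAut.conjNormal k c) = c := by
      rw [map_inv, MulAut.inv_apply_self]
    rw [hcancel, map_mul, map_mul, apply_conj_of_smul_eq hh', map_inv, mul_comm (l b),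
      mul_inv_cancel_right]
  · rw [linExt_eq_zero hx, linExt_eq_zero (mt hiff.1 hx)]

theorem linExt_mul_right (hprod : ∀ g : G, ∃ h ∈ H, ∃ a ∈ A, g = h * a) (hl : TrivialOn H l)
    (x : G) (a : A) : linExt H l (x * a) = linExt H l x * l a := by
  by_cases hx : x • l = l
  · have hxa : (x * (a : G)) • l = l := (mul_smul_eq_iff x a).2 hx
    obtain ⟨h, hh, b, hb, rfl⟩ := hprod x
    lift b to A using hb
    have e : h * b * a = h * ((b * a : A) : G) := by simp [mul_assoc]
    rw [e] at hxa ⊢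
    rw [linExt_mul hl hh _ hxa, linExt_mul hl hh _ hx]
    simp
  · rw [linExt_eq_zero hx, linExt_eq_zero (mt (mul_smul_eq_iff x a).1 hx), zero_mul]

end LinearExtension

theorem MulAction.sum_smul_eq {G X : Type*} [Group G] [Fintype G] [MulAction G X] [Fintype X]
    (F : X → ℂ) (l : X) :
    ∑ g : G, F (g • l) = Nat.card (MulAction.stabilizer G l) *
      ∑ m : X with m ∈ MulAction.orbit G l, F m := by
  rw [← Finset.sum_fiberwise_of_maps_to (s := Finset.univ) (t := {m | m ∈ MulAction.orbit G l})
    (g := fun g : G => g • l) (fun g _ => by simp), Finset.mul_sum]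
  refine Finset.sum_congr rfl fun m hm => ?_
  obtain ⟨g₀, rfl⟩ := (Finset.mem_filter.1 hm).2
  rw [Finset.sum_congr rfl (g := fun _ => F (g₀ • l)) fun g hg => by
    rw [(Finset.mem_filter.1 hg).2], Finset.sum_const, nsmul_eq_mul]
  congr 2
  rw [Nat.card_eq_fintype_card, ← Finset.card_univ]
  refine Finset.card_bij' (fun g hg => ⟨g₀⁻¹ * g, ?_⟩) (fun s _ => g₀ * s) ?_ ?_ ?_ ?_
  · rw [MulAction.mem_stabilizer_iff, mul_smul, (Finset.mem_filter.1 hg).2, inv_smul_smul]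
  · simp
  · rintro ⟨s, hs⟩ -
    simp [mul_smul, MulAction.mem_stabilizer_iff.1 hs]
  · simp
  · simp

theorem norm_coe_apply {B : Type*} [Group B] [Finite B] (l : B →* ℂ) (b : B) : ‖l b‖ = 1 :=
  Complex.norm_eq_one_of_pow_eq_one (by rw [← map_pow, pow_card_eq_one', map_one])
    (Nat.card_pos (α := B)).ne'

theorem finite_linChar {G : Type} [Group G] {A : Subgroup G} [IsMulCommutative A] [Finite A] :
    Finite (A →* ℂˣ) := by
  let _ : CommGroup A := { (inferInstance : Group A) with mul_comm := mul_comm' }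
  exact inferInstanceAs (Finite (A →* ℂˣ))

theorem sum_coe_apply_eq_ite {B : Type*} [Group B] [Fintype B] (l : B →* ℂˣ) :
    ∑ b : B, (l b : ℂ) = if l = 1 then (Fintype.card B : ℂ) else 0 := by
  split_ifs with h
  · simp [h]
  · refine sum_hom_units_eq_zero ((Units.coeHom ℂ).comp l) fun h1 => h ?_
    ext b
    simpa using DFunLike.congr_fun h1 b

theorem exists_trivialOn_apply_ne_one {G : Type} [Group G] {A H : Subgroup G} [IsMulCommutative A]
    [Finite A] {c : A} (hc : (c : G) ∉ H) :
    ∃ l : A →* ℂˣ, TrivialOn H l ∧ l c ≠ 1 := by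
  let _ : CommGroup A := { (inferInstance : Group A) with mul_comm := mul_comm' }
  have h := CommGroup.forall_monoidHom_apply_eq_one_iff (G := A) (M := ℂ) (H.subgroupOf A) c
  by_contra! h2
  refine hc (Subgroup.mem_subgroupOf.1 (h.1 fun l hl => h2 l fun a ha => hl a ?_))
  exact Subgroup.mem_subgroupOf.2 ha

theorem card_mul_sum_eq {G : Type} [Group G] [Fintype G] {A H : Subgroup G}
    (hprod : ∀ g : G, ∃ h ∈ H, ∃ a ∈ A, g = h * a) (F : G → ℂ)
    (hF : ∀ g, ∀ h ∈ H, F (g * h) = F g) :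
    (Fintype.card A : ℂ) * ∑ g : G, F g = Fintype.card G * ∑ b : A, F b := by
  have h1 (b : A) : ∑ g : G, F (b * g) = ∑ g : G, F g :=
    Equiv.sum_comp (Equiv.mulLeft (b : G)) F
  have h2 (g : G) : ∑ b : A, F (b * g) = ∑ b : A, F b := by
    obtain ⟨h, hh, a, ha, hg⟩ := hprod g⁻¹
    obtain rfl : g = a⁻¹ * h⁻¹ := by rw [← mul_inv_rev, ← hg, inv_inv]
    refine Fintype.sum_equiv (Equiv.mulRight (⟨a, ha⟩⁻¹ : A)) _ _ fun b => ?_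
    rw [← mul_assoc, hF _ _ (H.inv_mem hh)]
    rfl
  calc (Fintype.card A : ℂ) * ∑ g : G, F g = ∑ b : A, ∑ g : G, F (b * g) := by
        simp only [h1, Finset.sum_const, Finset.card_univ, nsmul_eq_mul]
    _ = ∑ g : G, ∑ b : A, F (b * g) := Finset.sum_comm
    _ = _ := by simp only [h2, Finset.sum_const, Finset.card_univ, nsmul_eq_mul]

theorem sum_trivialOn_apply {G : Type} [Group G] {A H : Subgroup G} [IsMulCommutative A]
    [Finite A] [Fintype (A →* ℂˣ)] (c : A) :
    ∑ l : A →* ℂˣ with TrivialOn H l, (l c : ℂ) =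
      if (c : G) ∈ H then (Finset.card {l : A →* ℂˣ | TrivialOn H l} : ℂ) else 0 := by
  split_ifs with hc
  · rw [Finset.sum_congr rfl (g := fun _ => (1 : ℂ)) fun l hl => by
      rw [(Finset.mem_filter.1 hl).2 c hc, Units.val_one]]
    simp
  · obtain ⟨m, hm, hmc⟩ := exists_trivialOn_apply_ne_one hc
    set S := ∑ l : A →* ℂˣ with TrivialOn H l, (l c : ℂ) with hS
    have h1 : S * m c = S := by
      rw [hS, Finset.sum_mul]
      refine Finset.sum_bij' (fun l _ => l * m) (fun l _ => l * m⁻¹) ?_ ?_ ?_ ?_ ?_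
      · intro l hl
        refine Finset.mem_filter.2 ⟨Finset.mem_univ _, fun a ha => ?_⟩
        rw [MonoidHom.mul_apply, (Finset.mem_filter.1 hl).2 a ha, hm a ha, one_mul]
      · intro l hl
        refine Finset.mem_filter.2 ⟨Finset.mem_univ _, fun a ha => ?_⟩
        rw [MonoidHom.mul_apply, MonoidHom.inv_apply, (Finset.mem_filter.1 hl).2 a ha, hm a ha,
          inv_one, one_mul]
      · intro l _
        ext
        simp
      · intro l _
        ext
        simp
      · simp
    by_contra hne
    exact hmc (Units.ext ((mul_eq_left₀ hne).1 h1))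

theorem card_mul_card_trivialOn {G : Type} [Group G] [Fintype G] {A H : Subgroup G}
    [IsMulCommutative A] [Fintype (A →* ℂˣ)]
    (hprod : ∀ g : G, ∃ h ∈ H, ∃ a ∈ A, g = h * a) :
    (Nat.card H : ℂ) * (Finset.card {l : A →* ℂˣ | TrivialOn H l} : ℂ) = Fintype.card G := by
  have hA : (Fintype.card A : ℂ) ≠ 0 := by simp
  have h1 := card_mul_sum_eq hprod (fun g => if g ∈ H then (1 : ℂ) else 0) fun g h hh => by
    simp [H.mul_mem_cancel_right hh]
  have h2 : ∑ g : G, (if g ∈ H then (1 : ℂ) else 0) = Nat.card H := by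
    have := Subgroup.sum_eq_sum_dite H fun _ => 1
    simpa using this.symm
  have h3 : (Finset.card {l : A →* ℂˣ | TrivialOn H l} : ℂ) *
      ∑ b : A, (if (b : G) ∈ H then (1 : ℂ) else 0) = Fintype.card A := by
    rw [Finset.mul_sum]
    simp only [mul_ite, mul_one, mul_zero, ← sum_trivialOn_apply]
    rw [Finset.sum_comm, Finset.sum_eq_single 1]
    · simp
    · intro l _ hl
      rw [sum_coe_apply_eq_ite, if_neg hl]
    · intro h
      exact absurd (Finset.mem_filter.2 ⟨Finset.mem_univ _, fun _ _ => rfl⟩) h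
  rw [h2] at h1
  refine mul_left_cancel₀ hA ?_
  rw [← mul_assoc, h1, mul_assoc, mul_comm (∑ b : A, _), h3, mul_comm]

section Sums

variable {G : Type} [Group G] [Fintype G] {A : Subgroup G} [A.Normal] [IsMulCommutative A]
  {H : Subgroup G} {l m : A →* ℂˣ}

theorem indChar_stabilizerExt [Fintype (A →* ℂˣ)] (hprod : ∀ g : G, ∃ h ∈ H, ∃ a ∈ A, g = h * a)
    (hl : TrivialOn H l) (x : G) :
    indChar (MulAction.stabilizer G l) (stabilizerExt hprod hl) x =
      ∑ m : A →* ℂˣ with m ∈ MulAction.orbit G l, linExt H m x := by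
  have key : indChar (MulAction.stabilizer G l) (stabilizerExt hprod hl) x =
      (Nat.card (MulAction.stabilizer G l) : ℂ)⁻¹ * ∑ g : G, linExt H (g • l) x := by
    refine congrArg _ (Finset.sum_congr rfl fun g _ => ?_)
    rw [← linExt_conj hprod hl]
    split_ifs with h
    · rfl
    · rw [linExt_eq_zero h]
  rw [key, MulAction.sum_smul_eq (fun m => linExt H m x), inv_mul_cancel_left₀]
  exact Nat.cast_ne_zero.2 Nat.card_pos.ne'

theorem sum_linExt_mul_conj_of_ne (hprod : ∀ g : G, ∃ h ∈ H, ∃ a ∈ A, g = h * a)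
    (hl : TrivialOn H l) (hm : TrivialOn H m) (hlm : l ≠ m) :
    ∑ x : G, linExt H l x * (starRingEnd ℂ) (linExt H m x) = 0 := by
  obtain ⟨a, ha⟩ : ∃ a, l a ≠ m a := by
    by_contra! h
    exact hlm (MonoidHom.ext h)
  set S := ∑ x : G, linExt H l x * (starRingEnd ℂ) (linExt H m x) with hS
  have h1 : S = S * ((l a : ℂ) * (starRingEnd ℂ) (m a : ℂ)) := by
    conv_lhs => rw [hS, ← Equiv.sum_comp (Equiv.mulRight (a : G))]
    rw [hS, Finset.sum_mul]
    refine Finset.sum_congr rfl fun x _ => ?_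
    rw [Equiv.coe_mulRight, linExt_mul_right hprod hl, linExt_mul_right hprod hm, map_mul]
    ring
  by_contra hne
  have h2 : (l a : ℂ) * (starRingEnd ℂ) (m a : ℂ) = 1 := (left_eq_mul₀ hne).1 h1
  have h3 : (m a : ℂ) * (starRingEnd ℂ) (m a : ℂ) = 1 := by
    have := norm_coe_apply ((Units.coeHom ℂ).comp m) a
    rw [Complex.mul_conj, Complex.normSq_eq_norm_sq]
    simp only [MonoidHom.comp_apply, Units.coeHom_apply] at this
    simp [this]
  have h4 : (starRingEnd ℂ) (m a : ℂ) ≠ 0 := by simp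
  exact ha (Units.ext (mul_right_cancel₀ h4 (h2.trans h3.symm)))

theorem sum_linExt_mul_conj_self (hprod : ∀ g : G, ∃ h ∈ H, ∃ a ∈ A, g = h * a)
    (hl : TrivialOn H l) :
    ∑ x : G, linExt H l x * (starRingEnd ℂ) (linExt H l x) =
      Nat.card (MulAction.stabilizer G l) := by
  have h1 (x : MulAction.stabilizer G l) :
      linExt H l x * (starRingEnd ℂ) (linExt H l x) = 1 := by
    have := norm_coe_apply (stabilizerExt hprod hl) x
    rw [Complex.mul_conj, Complex.normSq_eq_norm_sq]
    change ‖linExt H l x‖ = 1 at this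
    simp [this]
  rw [← Fintype.sum_of_injective (Subtype.val : MulAction.stabilizer G l → G)
    Subtype.val_injective (fun _ => 1) _ (fun x hx => ?_) fun k => (h1 k).symm]
  · simp
  · rw [linExt_eq_zero fun h => hx ⟨⟨x, h⟩, rfl⟩, zero_mul]

theorem cfInner_indChar_stabilizerExt_self [Fintype (A →* ℂˣ)]
    (hprod : ∀ g : G, ∃ h ∈ H, ∃ a ∈ A, g = h * a) (hl : TrivialOn H l) :
    cfInner G (indChar (MulAction.stabilizer G l) (stabilizerExt hprod hl))
      (indChar (MulAction.stabilizer G l) (stabilizerExt hprod hl)) = 1 := by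
  have horb {m : A →* ℂˣ} (hm : m ∈ MulAction.orbit G l) : TrivialOn H m := by
    obtain ⟨g, rfl⟩ := hm
    exact hl.smul hprod g
  have hstab {m : A →* ℂˣ} (hm : m ∈ MulAction.orbit G l) :
      ∑ n : A →* ℂˣ with n ∈ MulAction.orbit G l,
        ∑ x : G, linExt H m x * (starRingEnd ℂ) (linExt H n x) =
      Nat.card (MulAction.stabilizer G m) := by
    rw [Finset.sum_eq_single m]
    · exact sum_linExt_mul_conj_self hprod (horb hm)
    · intro n hn hne
      exact sum_linExt_mul_conj_of_ne hprod (horb hm) (horb (Finset.mem_filter.1 hn).2) hne.symm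
    · intro h
      simp [hm] at h
  have hsum : ∑ x : G, indChar (MulAction.stabilizer G l) (stabilizerExt hprod hl) x *
      (starRingEnd ℂ) (indChar (MulAction.stabilizer G l) (stabilizerExt hprod hl) x) =
      Fintype.card G := by
    simp only [indChar_stabilizerExt hprod hl, map_sum, Finset.sum_mul_sum]
    rw [Finset.sum_comm]
    have hstab' : ∀ m ∈ ({m | m ∈ MulAction.orbit G l} : Finset (A →* ℂˣ)),
        ∑ x : G, ∑ n : A →* ℂˣ with n ∈ MulAction.orbit G l,
          linExt H m x * (starRingEnd ℂ) (linExt H n x) =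
        Nat.card (MulAction.stabilizer G l) := by
      intro m hm
      have hm := (Finset.mem_filter.1 hm).2
      rw [Finset.sum_comm, hstab hm]
      obtain ⟨g, rfl⟩ := hm
      exact_mod_cast (Nat.card_congr
        (MulAction.stabilizerEquivStabilizer (g := g) (a := l) rfl).toEquiv).symm
    rw [Finset.sum_congr rfl hstab']
    have h1 := MulAction.sum_smul_eq (G := G) (fun _ => 1) l
    simp only [Finset.sum_const, nsmul_eq_mul, mul_one, Finset.card_univ] at h1 ⊢
    rw [h1, mul_comm]
  rw [cfInner, hsum, inv_mul_cancel₀]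
  simp

theorem indChar_one_eq_sum_linExt [Fintype (A →* ℂˣ)]
    (hprod : ∀ g : G, ∃ h ∈ H, ∃ a ∈ A, g = h * a) (x : G) :
    indChar H (fun _ => 1) x = ∑ l : A →* ℂˣ with TrivialOn H l, linExt H l x := by
  have hA : (Fintype.card A : ℂ) ≠ 0 := by simp
  have hH : (Nat.card H : ℂ) ≠ 0 := by simp
  have h1 := card_mul_sum_eq hprod (fun g => if g⁻¹ * x * g ∈ H then (1 : ℂ) else 0)
    fun g h hh => by
      have : (g * h)⁻¹ * x * (g * h) = h⁻¹ * (g⁻¹ * x * g) * h := by group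
      simp only [this, H.mul_mem_cancel_right hh, H.mul_mem_cancel_left (H.inv_mem hh)]
  have h2 : (Finset.card {l : A →* ℂˣ | TrivialOn H l} : ℂ) *
      ∑ b : A, (if (b : G)⁻¹ * x * b ∈ H then (1 : ℂ) else 0) =
      Fintype.card A * ∑ l : A →* ℂˣ with TrivialOn H l, linExt H l x := by
    obtain ⟨h, hh, a, ha, rfl⟩ := hprod x
    lift a to A using ha
    have e (b : A) : (b : G)⁻¹ * (h * a) * b ∈ H ↔
        ((MulAut.conjNormal h⁻¹ b⁻¹ * a * b : A) : G) ∈ H := by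
      have : (b : G)⁻¹ * (h * a) * b = h * ((MulAut.conjNormal h⁻¹ b⁻¹ * a * b : A) : G) := by
        simp [mul_assoc]
      rw [this, H.mul_mem_cancel_left hh]
    simp only [e]
    rw [Finset.mul_sum, Finset.mul_sum]
    simp only [mul_ite, mul_one, mul_zero, ← sum_trivialOn_apply]
    rw [Finset.sum_comm]
    refine Finset.sum_congr rfl fun l hl => ?_
    have hl := (Finset.mem_filter.1 hl).2
    have e2 (b : A) : ((l (MulAut.conjNormal h⁻¹ b⁻¹ * a * b) : ℂˣ) : ℂ) =
        l a * (((h • l)⁻¹ * l) b : ℂˣ) := by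
      rw [MonoidHom.mul_apply, MonoidHom.inv_apply, conj_smul_apply, map_mul, map_mul, map_inv,
        map_inv]
      push_cast
      ring
    simp only [e2]
    rw [← Finset.mul_sum, sum_coe_apply_eq_ite]
    by_cases hs : h • l = l
    · rw [linExt_mul hl hh a ((mul_smul_eq_iff h a).2 hs), if_pos (by ext; simp [hs]), mul_comm]
    · rw [linExt_eq_zero (mt (mul_smul_eq_iff h a).1 hs),
        if_neg fun h' => hs (inv_mul_eq_one.1 h')]
      simp
  have h3 : indChar H (fun _ => 1) x =
      (Nat.card H : ℂ)⁻¹ * ∑ g : G, if g⁻¹ * x * g ∈ H then (1 : ℂ) else 0 := by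
    simp [indChar]
  rw [h3, inv_mul_eq_iff_eq_mul₀ hH]
  refine mul_left_cancel₀ hA ?_
  rw [h1, ← card_mul_card_trivialOn hprod, mul_assoc, h2]
  ring

end Sums

/-- If `A` is an abelian normal subgroup of the finite group `G` and `H` is a
subgroup with `G = HA`, then `Ind_H^G 1_H` is a sum of monomial characters `Ind_{H_i}^G χ_i`
with each `χ_i` one-dimensional; in particular every irreducible constituent of `Ind_H^G 1_H`
is a monomial character of `G`. -/
theorem induced_trivial_eq_sum_monomial_of_compl
    (G : Type) [Group G] [Fintype G]
    (A : Subgroup G) (hAnormal : A.Normal) (hAcomm : ∀ a ∈ A, ∀ b ∈ A, a * b = b * a)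
    (H : Subgroup G)
    (hprod : ∀ g : G, ∃ h ∈ H, ∃ a ∈ A, g = h * a) :
    ∃ (n : ℕ) (Hs : Fin n → Subgroup G) (χ : (i : Fin n) → (Hs i → ℂ)),
      (∀ i, IsChar (Hs i) (χ i) ∧ χ i 1 = 1) ∧
      indChar H (fun _ => 1) = ∑ i, indChar (Hs i) (χ i) ∧
      (∀ ψ : G → ℂ, IsIrrChar G ψ → cfInner G (indChar H (fun _ => 1)) ψ ≠ 0 →
        ∃ (K : Subgroup G) (θ : K → ℂ), IsChar K θ ∧ θ 1 = 1 ∧ ψ = indChar K θ) := by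
  have : IsMulCommutative A := ⟨⟨fun a b => Subtype.ext (hAcomm a a.2 b b.2)⟩⟩
  have : Finite (A →* ℂˣ) := finite_linChar
  let _ : Fintype (A →* ℂˣ) := Fintype.ofFinite _
  let q : (A →* ℂˣ) → MulAction.orbitRel.Quotient G (A →* ℂˣ) := Quotient.mk''
  let I := {c : MulAction.orbitRel.Quotient G (A →* ℂˣ) // TrivialOn H c.out}
  have hq (l m : A →* ℂˣ) : q l = q m ↔ l ∈ MulAction.orbit G m :=
    Quotient.eq''.trans MulAction.orbitRel_apply
  have hqout (c : MulAction.orbitRel.Quotient G (A →* ℂˣ)) : q c.out = c := Quotient.out_eq' c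
  have hmem (l : A →* ℂˣ) : TrivialOn H (q l).out ↔ TrivialOn H l := by
    have h1 : l ∈ MulAction.orbit G (q l).out := (hq _ _).1 (hqout _).symm
    have h2 : (q l).out ∈ MulAction.orbit G l := (hq _ _).1 (hqout _)
    obtain ⟨g, hg⟩ := h1
    obtain ⟨k, hk⟩ := h2
    exact ⟨fun h => hg ▸ h.smul hprod g, fun h => hk ▸ h.smul hprod k⟩
  let _ : Fintype I := Fintype.ofFinite _
  let e := (Fintype.equivFin I).symm
  have hsum : indChar H (fun _ => 1) = ∑ i, indChar (MulAction.stabilizer G (e i).1.out)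
      (stabilizerExt hprod (e i).2) := by
    funext x
    rw [indChar_one_eq_sum_linExt hprod, Finset.sum_apply,
      e.sum_comp fun c : I => indChar (MulAction.stabilizer G c.1.out) (stabilizerExt hprod c.2) x]
    simp only [indChar_stabilizerExt, Finset.sum_filter]
    rw [Finset.sum_comm]
    refine Finset.sum_congr rfl fun l _ => ?_
    have horb (c : I) : l ∈ MulAction.orbit G c.1.out ↔ q l = c.1 := by rw [← hq, hqout]
    simp only [horb]
    split_ifs with hl
    · rw [Finset.sum_eq_single (⟨q l, (hmem l).2 hl⟩ : I)]
      · simp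
      · exact fun c _ hc => if_neg fun h => hc (Subtype.ext h.symm)
      · simp
    · refine (Finset.sum_eq_zero fun c _ => if_neg fun h => hl ((hmem l).1 ?_)).symm
      rw [h]
      exact c.2
  refine ⟨Fintype.card I, fun i => MulAction.stabilizer G (e i).1.out,
    fun i => stabilizerExt hprod (e i).2, fun i => ⟨isChar_of_monoidHom _, map_one _⟩, hsum, ?_⟩
  intro ψ hψ hne
  rw [hsum, cfInner_sum_left] at hne
  obtain ⟨i, -, hi⟩ := Finset.exists_ne_zero_of_sum_ne_zero hne
  refine ⟨_, stabilizerExt hprod (e i).2, isChar_of_monoidHom _, map_one _, ?_⟩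
  obtain ⟨m, hm⟩ := cfInner_indChar_isNat _ _ (isChar_of_monoidHom (stabilizerExt hprod (e i).2)) ψ
    (hψ.imp fun _ h => h.2)
  refine (eq_of_cfInner_natCast _ _ (cfInner_indChar_stabilizerExt_self hprod (e i).2)
    (cfInner_self_of_isIrrChar ψ hψ) m ?_ hm).symm
  rintro rfl
  exact hi (by simpa using hm)
end

section
/- Let G be a finite group equipped with a weak arithmetic Heilbronn character datum {n(H, φ)}. If n(G, Reg_G) ≤ 1, then n(G, χ) ≥ 0 for every irreducible character χ of G. -/
open scoped Classical

open Module CategoryTheory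

/-- The symmetric pairing `|G|⁻¹ ∑ g, f g * h g⁻¹` on complex functions on a finite group. -/
noncomputable def charPairing (G : Type) [Group G] [Fintype G] (f h : G → ℂ) : ℂ :=
  (Nat.card G : ℂ)⁻¹ * ∑ g : G, f g * h g⁻¹

section Characters

variable {G : Type} [Group G]

lemma isChar_representation {V : Type} [AddCommGroup V] [Module ℂ V] [FiniteDimensional ℂ V]
    (ρ : Representation ℂ G V) : IsChar G ρ.character :=
  ⟨FDRep.of ρ, rfl⟩

lemma IsChar.exists_representation {f : G → ℂ} (hf : IsChar G f) :
    ∃ (V : Type) (_ : AddCommGroup V) (_ : Module ℂ V) (_ : FiniteDimensional ℂ V)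
      (ρ : Representation ℂ G V), f = ρ.character := by
  obtain ⟨V, rfl⟩ := hf
  exact ⟨V, inferInstance, inferInstance, inferInstance, V.ρ, rfl⟩

lemma IsIrrChar.isChar {f : G → ℂ} (hf : IsIrrChar G f) : IsChar G f := by
  obtain ⟨V, -, rfl⟩ := hf
  exact ⟨V, rfl⟩

lemma isChar_zero : IsChar G (0 : G → ℂ) := by
  have h := isChar_representation (1 : Representation ℂ G PUnit)
  convert h
  ext g
  simp [Representation.character, Module.finrank_zero_of_subsingleton]

lemma IsChar.add {f₁ f₂ : G → ℂ} (h₁ : IsChar G f₁) (h₂ : IsChar G f₂) :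
    IsChar G (f₁ + f₂) := by
  obtain ⟨V, _, _, _, ρ, rfl⟩ := h₁.exists_representation
  obtain ⟨W, _, _, _, σ, rfl⟩ := h₂.exists_representation
  convert isChar_representation (ρ.prod σ)
  ext g
  exact (LinearMap.trace_prodMap' (ρ g) (σ g)).symm

lemma isChar_monoidHom (ψ : G →* ℂ) : IsChar G ψ := by
  let ρ : Representation ℂ G ℂ := (Algebra.lmul ℂ ℂ : ℂ →* (ℂ →ₗ[ℂ] ℂ)).comp ψ
  convert isChar_representation ρ
  ext g
  simp [ρ, Representation.character, LinearMap.trace_eq_matrix_trace ℂ (Basis.singleton Unit ℂ),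
    Matrix.trace, LinearMap.toMatrix_apply]

lemma IsChar.apply_conj {f : G → ℂ} (hf : IsChar G f) (g x : G) : f (g * x * g⁻¹) = f x := by
  obtain ⟨V, rfl⟩ := hf
  exact V.char_conj x g

variable [Fintype G]

lemma isIrrChar_of_isIrreducible {V : Type} [AddCommGroup V] [Module ℂ V]
    [FiniteDimensional ℂ V] (ρ : Representation ℂ G V) [ρ.IsIrreducible] :
    IsIrrChar G ρ.character := by
  have hcard : (Nat.card G : ℂ) ≠ 0 := Nat.cast_ne_zero.mpr Nat.card_pos.ne'
  have := invertibleOfNonzero hcard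
  refine ⟨FDRep.of ρ, (FDRep.simple_iff_char_is_norm_one _).mpr ?_, rfl⟩
  have h := Representation.char_orthonormal ρ ρ
  rw [if_pos ⟨Representation.Equiv.refl ρ⟩, inv_mul_eq_one₀ hcard] at h
  exact h.symm

lemma charPairing_irr {f h : G → ℂ} (hf : IsIrrChar G f) (hh : IsIrrChar G h) :
    charPairing G f h = if f = h then 1 else 0 := by
  obtain ⟨V, hV, rfl⟩ := hf
  obtain ⟨W, hW, rfl⟩ := hh
  have hcard : (Nat.card G : ℂ) ≠ 0 := Nat.cast_ne_zero.mpr Nat.card_pos.ne'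
  have := invertibleOfNonzero hcard
  by_cases h : V.character = W.character
  · have hV' := (FDRep.simple_iff_char_is_norm_one V).mp hV
    rw [if_pos h, charPairing, ← h, hV', inv_mul_cancel₀ hcard]
  · rw [if_neg h, charPairing, FDRep.char_orthonormal, if_neg]
    rintro ⟨i⟩
    exact h (FDRep.char_iso i)

lemma charPairing_add_left (f₁ f₂ h : G → ℂ) :
    charPairing G (f₁ + f₂) h = charPairing G f₁ h + charPairing G f₂ h := by
  simp [charPairing, add_mul, Finset.sum_add_distrib, mul_add]

lemma charPairing_sum_left {ι : Type*} (s : Finset ι) (c : ι → ℂ) (f : ι → G → ℂ) (h : G → ℂ) :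
    charPairing G (∑ i ∈ s, c i • f i) h = ∑ i ∈ s, c i * charPairing G (f i) h := by
  simp only [charPairing, Finset.sum_apply, Pi.smul_apply, smul_eq_mul, Finset.sum_mul,
    Finset.mul_sum]
  rw [Finset.sum_comm]
  exact Finset.sum_congr rfl fun _ _ => Finset.sum_congr rfl fun _ _ => by ring

lemma charPairing_comm (f h : G → ℂ) : charPairing G f h = charPairing G h f := by
  unfold charPairing
  congr 1
  rw [← Equiv.sum_comp (Equiv.inv G)]
  simp [mul_comm]

lemma charPairing_regChar (h : G → ℂ) : charPairing G (regChar G) h = h 1 := by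
  simp [charPairing, regChar, Fintype.card_ne_zero]

lemma finite_setOf_isIrrChar : {f : G → ℂ | IsIrrChar G f}.Finite := by
  refine LinearIndependent.setFinite (R := ℂ) (linearIndependent_iff'.mpr fun s c hc i hi => ?_)
  have h := charPairing_sum_left s c (fun j => (j : G → ℂ)) i
  rw [hc, Finset.sum_congr rfl fun j _ => by
    rw [charPairing_irr j.2 i.2]] at h
  simpa [charPairing, Subtype.ext_iff.symm, hi] using h.symm

lemma character_mem_closure_irr (d : ℕ) : ∀ (V : Type) [AddCommGroup V] [Module ℂ V]
    [FiniteDimensional ℂ V] (ρ : Representation ℂ G V), finrank ℂ V = d →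
    ρ.character ∈ AddSubmonoid.closure {f : G → ℂ | IsIrrChar G f} := by
  induction d using Nat.strong_induction_on with
  | _ d ih =>
  intro V _ _ _ ρ hd
  by_cases hirr : ρ.IsIrreducible
  · exact AddSubmonoid.subset_closure (isIrrChar_of_isIrreducible ρ)
  by_cases hV : Subsingleton V
  · have : ρ.character = 0 := by
      ext g
      simp [Representation.character, Subsingleton.elim (ρ g) 0]
    rw [this]
    exact zero_mem _
  rw [not_subsingleton_iff_nontrivial] at hV
  have hnt : Nontrivial (Subrepresentation ρ) := by
    refine ⟨⊥, ⊤, fun h => ?_⟩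
    have h' : (⊥ : Submodule ℂ V) = ⊤ := congrArg Subrepresentation.toSubmodule h
    exact bot_ne_top h'
  obtain ⟨p, hp, hp'⟩ : ∃ p : Subrepresentation ρ, p ≠ ⊥ ∧ p ≠ ⊤ := by
    by_contra! h
    exact hirr { eq_bot_or_eq_top := fun p => or_iff_not_imp_left.mpr (h p) }
  obtain ⟨q, hpq⟩ := exists_isCompl p
  have hc : IsCompl p.toSubmodule q.toSubmodule := by
    constructor
    · exact disjoint_iff.mpr (congrArg Subrepresentation.toSubmodule hpq.inf_eq_bot)
    · exact codisjoint_iff.mpr (congrArg Subrepresentation.toSubmodule hpq.sup_eq_top)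
  have hsum : finrank ℂ p.toSubmodule + finrank ℂ q.toSubmodule = finrank ℂ V :=
    Submodule.finrank_add_eq_of_isCompl hc
  have hp0 : finrank ℂ p.toSubmodule ≠ 0 := fun h =>
    hp (Subrepresentation.toSubmodule_injective (Submodule.finrank_eq_zero.mp h))
  have hpd : finrank ℂ p.toSubmodule < finrank ℂ V :=
    Submodule.finrank_lt fun h => hp' (Subrepresentation.toSubmodule_injective h)
  have key : ρ.character = p.toRepresentation.character + q.toRepresentation.character := by
    ext g
    have he : ρ g = (Submodule.prodEquivOfIsCompl _ _ hc).conj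
        ((p.toRepresentation g).prodMap (q.toRepresentation g)) := by
      refine LinearMap.ext fun v => ?_
      obtain ⟨w, rfl⟩ := (Submodule.prodEquivOfIsCompl _ _ hc).surjective v
      simp [LinearEquiv.conj_apply, Subrepresentation.toRepresentation]
    simp only [Representation.character, Pi.add_apply]
    rw [he, LinearMap.trace_conj', LinearMap.trace_prodMap']
  rw [key]
  exact add_mem (ih _ (by omega) _ _ rfl) (ih _ (by omega) _ _ rfl)

lemma IsChar.mem_closure_irr {f : G → ℂ} (hf : IsChar G f) :
    f ∈ AddSubmonoid.closure {f : G → ℂ | IsIrrChar G f} := by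
  obtain ⟨V, _, _, _, ρ, rfl⟩ := hf.exists_representation
  exact character_mem_closure_irr _ V ρ rfl

end Characters

section Induction

variable {G : Type} [Group G] [Fintype G]

/-- The action of `H` on functions on `G` by left translation twisted by a linear character. -/
noncomputable def twistedTranslation (H : Subgroup G) (ψ : H →* ℂ) :
    Representation ℂ H (G → ℂ) where
  toFun h := ψ h • LinearMap.funLeft ℂ ℂ (fun x => (h : G)⁻¹ * x)
  map_one' := by
    ext
    simp [LinearMap.funLeft]
  map_mul' h k := by
    refine LinearMap.ext fun f => funext fun x => ?_
    simp [LinearMap.funLeft, mul_assoc, mul_left_comm]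

/-- The right translation action on functions that are equivariant under a subgroup. -/
noncomputable def equivariantRightTranslation (H : Subgroup G) (ψ : H →* ℂ) :
    Representation ℂ G (twistedTranslation H ψ).invariants where
  toFun g := (LinearMap.funLeft ℂ ℂ (fun x => x * g)).restrict (by
    intro f hf h
    have hf' := hf h
    ext x
    simpa [twistedTranslation, LinearMap.funLeft, mul_assoc] using congrFun hf' (x * g))
  map_one' := by
    ext
    simp [LinearMap.funLeft]
  map_mul' g k := by
    ext
    simp [LinearMap.funLeft, mul_assoc]

lemma trace_funLeft {α : Type} [Fintype α] (e : α → α) :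
    LinearMap.trace ℂ (α → ℂ) (LinearMap.funLeft ℂ ℂ e) = ∑ x, if e x = x then 1 else 0 := by
  rw [LinearMap.trace_eq_matrix_trace ℂ (Pi.basisFun ℂ α), Matrix.trace]
  refine Finset.sum_congr rfl fun x _ => ?_
  simp [LinearMap.funLeft, Pi.single_apply]

lemma isChar_indChar (H : Subgroup G) (ψ : H →* ℂ) : IsChar G (indChar H ψ) := by
  have : Invertible (Fintype.card H : ℂ) :=
    invertibleOfNonzero (Nat.cast_ne_zero.mpr Fintype.card_ne_zero)
  convert isChar_representation (equivariantRightTranslation H ψ)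
  ext g
  have hproj := Representation.isProj_averageMap (twistedTranslation H ψ)
  have hmem : ∀ f, ((LinearMap.funLeft ℂ ℂ (fun x => x * g)) ∘ₗ
      (twistedTranslation H ψ).averageMap) f ∈ (twistedTranslation H ψ).invariants :=
    fun f => (equivariantRightTranslation H ψ g ⟨_, hproj.map_mem f⟩).2
  have hres : equivariantRightTranslation H ψ g = LinearMap.restrict _ (fun x _ => hmem x) := by
    refine LinearMap.ext fun f => Subtype.ext ?_
    exact congrArg (LinearMap.funLeft ℂ ℂ (fun x => x * g)) (hproj.map_id f f.2).symm
  rw [Representation.character, hres, LinearMap.trace_restrict_eq_of_forall_mem _ _ hmem]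
  have hcomp : (LinearMap.funLeft ℂ ℂ (fun x => x * g)) ∘ₗ
      (twistedTranslation H ψ).averageMap = (Nat.card H : ℂ)⁻¹ • ∑ h : H,
        ψ h • LinearMap.funLeft ℂ ℂ (fun x : G => (h : G)⁻¹ * (x * g)) := by
    refine LinearMap.ext fun f => funext fun x => ?_
    simp [GroupAlgebra.average, twistedTranslation, LinearMap.funLeft, Finset.sum_apply]
  rw [hcomp]
  simp only [map_smul, map_sum, trace_funLeft, smul_eq_mul, indChar]
  congr 1
  rw [← Equiv.sum_comp (Equiv.inv G)]
  simp_rw [Finset.mul_sum]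
  rw [Finset.sum_comm]
  refine Finset.sum_congr rfl fun x _ => ?_
  have hiff : ∀ h : H, (h : G)⁻¹ * (x * g) = x ↔ (h : G) = x * g * x⁻¹ := fun h => by
    rw [inv_mul_eq_iff_eq_mul, eq_mul_inv_iff_mul_eq, eq_comm]
  simp only [Equiv.inv_apply, inv_inv, hiff, mul_ite, mul_one, mul_zero]
  split_ifs with hx
  · rw [Fintype.sum_eq_single ⟨_, hx⟩ fun h hne => if_neg fun he => hne (Subtype.ext he),
      if_pos rfl]
  · exact (Finset.sum_eq_zero fun (h : H) _ => if_neg fun he : (h : G) = x * g * x⁻¹ =>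
      hx (he ▸ h.2)).symm

lemma charPairing_indChar (H : Subgroup G) (f : H → ℂ) (θ : G → ℂ)
    (hθ : ∀ g x, θ (g * x * g⁻¹) = θ x) :
    charPairing G (indChar H f) θ = charPairing H f (fun h => θ h) := by
  let F : G → ℂ := fun y => if h : y ∈ H then f ⟨y, h⟩ else 0
  have hF : ∑ y, F y * θ y⁻¹ = ∑ h : H, f h * θ (h : G)⁻¹ := by
    refine (Fintype.sum_of_injective Subtype.val Subtype.val_injective _ _ ?_ ?_).symm
    · intro y hy
      have : y ∉ H := fun h => hy ⟨⟨y, h⟩, rfl⟩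
      simp [F, this]
    · simp [F]
  have hconj : ∀ g : G, ∑ x, F (g⁻¹ * x * g) * θ x⁻¹ = ∑ y, F y * θ y⁻¹ := by
    intro g
    rw [← Equiv.sum_comp (MulAut.conj g).toEquiv]
    refine Finset.sum_congr rfl fun y _ => ?_
    have : (g * y * g⁻¹)⁻¹ = g * y⁻¹ * g⁻¹ := by group
    have hy : g⁻¹ * (g * y * g⁻¹) * g = y := by group
    simp [-mul_inv_rev, this, hθ, hy]
  have hcard : (Nat.card G : ℂ) ≠ 0 := Nat.cast_ne_zero.mpr Nat.card_pos.ne'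
  calc charPairing G (indChar H f) θ
      = (Nat.card G : ℂ)⁻¹ * ((Nat.card H : ℂ)⁻¹ *
          ∑ g : G, ∑ x, F (g⁻¹ * x * g) * θ x⁻¹) := by
        rw [Finset.sum_comm]
        simp only [charPairing, indChar, Finset.mul_sum, Finset.sum_mul, F, mul_assoc]
    _ = charPairing H f (fun h => θ h) := by
        simp only [hconj, hF, Finset.sum_const, Finset.card_univ, nsmul_eq_mul, charPairing,
          InvMemClass.coe_inv, ← Nat.card_eq_fintype_card]
        field_simp

lemma regChar_eq_indChar_bot :
    regChar G = indChar (⊥ : Subgroup G) (1 : (⊥ : Subgroup G) →* ℂ) := by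
  ext x
  have h : ∀ g : G, g⁻¹ * x * g ∈ (⊥ : Subgroup G) ↔ x = 1 := fun g => by
    rw [Subgroup.mem_bot]
    constructor
    · intro h
      have : x = g * (g⁻¹ * x * g) * g⁻¹ := by group
      rw [this, h]
      group
    · rintro rfl
      group
  simp [regChar, indChar, h]

end Induction

/-- Fourier inversion on a finite commutative group bounds a function whose Fourier coefficients
are nonnegative by its value at the identity. -/
lemma norm_le_of_charPairing_nonneg {A : Type} [CommGroup A] [Fintype A] (θ : A → ℂ)
    (m : (A →* ℂ) → ℝ) (hm : ∀ ψ, 0 ≤ m ψ) (hθ : ∀ ψ : A →* ℂ, charPairing A ψ θ = m ψ)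
    (r : ℝ) (hr : θ 1 = r) (a : A) : ‖θ a‖ ≤ r := by
  let e : AddChar (Additive A) ℂ → A →* ℂ := fun ψ => 
    { toFun := fun a => ψ (Additive.ofMul a)
      map_one' := by simp
      map_mul' := fun a b => by simp [AddChar.map_add_eq_mul] }
  have hinv : ∀ a, θ a = ∑ ψ : AddChar (Additive A) ℂ, (m (e ψ) : ℂ) * e ψ a := by
    intro a
    have hsum : ∀ b, ∑ ψ : AddChar (Additive A) ℂ, e ψ b * e ψ a =
        if b = a⁻¹ then (Nat.card A : ℂ) else 0 := by
      intro b
      have h := AddChar.sum_apply_eq_ite (Additive.ofMul (b * a))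
      simp only [ofMul_eq_zero, mul_eq_one_iff_eq_inv] at h
      simp_rw [← map_mul]
      simpa [e] using h
    simp_rw [← hθ, charPairing, mul_assoc, ← Finset.mul_sum, Finset.sum_mul]
    rw [Finset.sum_comm]
    simp_rw [mul_right_comm _ (θ _), ← Finset.sum_mul, hsum]
    simp
  have hr' : r = ∑ ψ : AddChar (Additive A) ℂ, m (e ψ) := by
    have h := hinv 1
    simp only [map_one, mul_one, hr] at h
    exact_mod_cast h
  rw [hinv, hr']
  refine (norm_sum_le _ _).trans (Finset.sum_le_sum fun ψ _ => ?_)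
  have : ‖e ψ a‖ = 1 := AddChar.norm_apply ψ _
  simp [this, abs_of_nonneg (hm _)]

/-- **weak arithmetic Stark lemma.** For a weak arithmetic Heilbronn character
datum `(nG, n)` on a finite group `G`, if `n(G, Reg_G) ≤ 1` then `n(G, χ) ≥ 0` for every
irreducible character `χ` of `G`. -/
theorem weak_arithmetic_stark_lemma
    (G : Type) [Group G] [Fintype G]
    (nG : (G → ℂ) → ℤ) (n : (H : Subgroup G) → (H → ℂ) → ℤ)
    (haddG : ∀ φ₁ φ₂ : G → ℂ, IsChar G φ₁ → IsChar G φ₂ →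
      nG (φ₁ + φ₂) = nG φ₁ + nG φ₂)
    (haddH : ∀ (H : Subgroup G), IsCyclic H → ∀ φ₁ φ₂ : H → ℂ,
      IsChar H φ₁ → IsChar H φ₂ → n H (φ₁ + φ₂) = n H φ₁ + n H φ₂)
    (hind : ∀ (H : Subgroup G), IsCyclic H → ∀ φ : H → ℂ, IsChar H φ →
      nG (indChar H φ) = n H φ)
    (hnonneg : ∀ (H : Subgroup G), IsCyclic H → ∀ φ : H → ℂ, IsChar H φ → 0 ≤ n H φ)
    (hreg : nG (regChar G) ≤ 1) :
    ∀ χ : G → ℂ, IsIrrChar G χ → 0 ≤ nG χ := by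
  have nG_zero : nG 0 = 0 := by
    have h := haddG 0 0 isChar_zero isChar_zero
    rw [add_zero] at h
    omega
  set S := (finite_setOf_isIrrChar (G := G)).toFinset with hS
  have memS : ∀ f, f ∈ S ↔ IsIrrChar G f := fun f => by simp [hS]
  set θ : G → ℂ := ∑ χ ∈ S, (nG χ : ℂ) • χ with hθ
  have pair_irr : ∀ χ, IsIrrChar G χ → charPairing G χ θ = nG χ := by
    intro χ hχ
    rw [charPairing_comm, hθ, charPairing_sum_left S (fun χ => (nG χ : ℂ)) (fun χ => χ),
      Finset.sum_congr rfl fun ψ hψ => by rw [charPairing_irr ((memS ψ).mp hψ) hχ]]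
    simp [(memS χ).mpr hχ]
  have pair : ∀ f, IsChar G f → charPairing G f θ = nG f := by
    intro f hf
    suffices h : IsChar G f ∧ charPairing G f θ = nG f from h.2
    refine AddSubmonoid.closure_induction
      (motive := fun f _ => IsChar G f ∧ charPairing G f θ = nG f) ?_ ?_ ?_ hf.mem_closure_irr
    · exact fun χ hχ => ⟨IsIrrChar.isChar hχ, pair_irr χ hχ⟩
    · exact ⟨isChar_zero, by simp [charPairing, nG_zero]⟩
    · rintro f₁ f₂ - - ⟨h₁, e₁⟩ ⟨h₂, e₂⟩
      exact ⟨h₁.add h₂, by rw [charPairing_add_left, e₁, e₂, haddG _ _ h₁ h₂, Int.cast_add]⟩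
  have θ_conj : ∀ g x, θ (g * x * g⁻¹) = θ x := by
    intro g x
    simp only [hθ, Finset.sum_apply, Pi.smul_apply]
    refine Finset.sum_congr rfl fun χ hχ => ?_
    rw [((memS χ).mp hχ).isChar.apply_conj]
  have reg_isChar : IsChar G (regChar G) := by
    rw [regChar_eq_indChar_bot]
    exact isChar_indChar _ _
  have θ_one : θ 1 = nG (regChar G) := by
    rw [← pair _ reg_isChar, charPairing_regChar]
  have reg_nonneg : 0 ≤ nG (regChar G) := by
    have hbot : IsCyclic (⊥ : Subgroup G) := inferInstance
    rw [regChar_eq_indChar_bot, hind _ hbot _ (isChar_monoidHom _)]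
    exact hnonneg _ hbot _ (isChar_monoidHom _)
  have bound : ∀ g, ‖θ g‖ ≤ nG (regChar G) := by
    intro g
    have hcyc : IsCyclic (Subgroup.zpowers g) := inferInstance
    let : CommGroup (Subgroup.zpowers g) := hcyc.commGroup
    refine norm_le_of_charPairing_nonneg (A := Subgroup.zpowers g) (fun h => θ h)
      (fun ψ => (n (Subgroup.zpowers g) ψ : ℝ)) (fun ψ => ?_) (fun ψ => ?_) _ ?_
      ⟨g, Subgroup.mem_zpowers g⟩
    · exact_mod_cast hnonneg _ hcyc _ (isChar_monoidHom ψ)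
    · have h := charPairing_indChar (Subgroup.zpowers g) ψ θ θ_conj
      rw [pair _ (isChar_indChar _ ψ), hind _ hcyc _ (isChar_monoidHom ψ)] at h
      simpa using h.symm
    · simpa using θ_one
  have norm_sq : (∑ χ ∈ S, nG χ ^ 2) ≤ nG (regChar G) ^ 2 := by
    have h : charPairing G θ θ = ((∑ χ ∈ S, nG χ ^ 2 : ℤ) : ℂ) := by
      have h' := charPairing_sum_left S (fun χ => (nG χ : ℂ)) (fun χ => χ) θ
      rw [← hθ] at h'
      rw [h', Int.cast_sum]
      refine Finset.sum_congr rfl fun χ hχ => ?_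
      rw [pair_irr χ ((memS χ).mp hχ), Int.cast_pow, sq]
    have hle : ‖charPairing G θ θ‖ ≤ (nG (regChar G) : ℝ) ^ 2 := by
      have hsum : ‖∑ g, θ g * θ g⁻¹‖ ≤ Nat.card G * (nG (regChar G) : ℝ) ^ 2 := by
        refine (norm_sum_le_of_le _ (fun g _ => ?_)).trans_eq
          (b := ∑ _g : G, (nG (regChar G) : ℝ) ^ 2) (by simp)
        rw [norm_mul, sq]
        exact mul_le_mul (bound g) (bound _) (norm_nonneg _) ((norm_nonneg _).trans (bound g))
      have hcard : (0 : ℝ) < Nat.card G := Nat.cast_pos.mpr Nat.card_pos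
      rw [charPairing, norm_mul, norm_inv, Complex.norm_natCast, inv_mul_le_iff₀ hcard]
      exact hsum
    rw [h, Complex.norm_intCast] at hle
    exact_mod_cast (le_abs_self _).trans hle
  intro χ hχ
  by_contra! hneg
  have hχS : χ ∈ S := (memS χ).mpr hχ
  have hsplit := Finset.add_sum_erase S (fun ψ => nG ψ ^ 2) hχS
  have hrest : 0 ≤ ∑ ψ ∈ S.erase χ, nG ψ ^ 2 := Finset.sum_nonneg fun _ _ => sq_nonneg _
  have hreg1 : nG (regChar G) = 1 := by
    by_contra h
    have : nG (regChar G) = 0 := by omega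
    rw [this] at norm_sq
    nlinarith
  rw [hreg1] at norm_sq
  have hzero : ∑ ψ ∈ S.erase χ, nG ψ ^ 2 = 0 := by nlinarith
  have hχ1 : nG χ = -1 := by nlinarith
  have hθχ : θ = -χ := by
    rw [hθ, ← Finset.add_sum_erase S _ hχS, Finset.sum_eq_zero, hχ1]
    · simp
    · intro ψ hψ
      have h := (Finset.sum_eq_zero_iff_of_nonneg fun _ _ => sq_nonneg _).mp hzero ψ hψ
      simp [pow_eq_zero_iff] at h
      simp [h]
  obtain ⟨V, -, rfl⟩ := hχ
  rw [hθχ, hreg1, Pi.neg_apply, FDRep.char_one] at θ_one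
  have : -(finrank ℂ V : ℤ) = 1 := by exact_mod_cast θ_one
  omega
end
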